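/- Let ρ be a real-valued radial neutral Schwartz function on ℝ², let m > 0, I > 0, let v ∈ ℝ² with |v| < 1 and ω ∈ ℝ. Then the soliton (A_{v,ω}, Π_{v,ω}) is a critical point of the reduced Hamiltonian H_{P,M} with P = P_{v,ω}, M = M_{v,ω}: for every pair of Schwartz vector fields a, π : ℝ² → ℝ² with div a = 0 and div π = 0, the function ε ↦ H_{P,M}(A_{v,ω}+εa, Π_{v,ω}+επ) is differentiable at ε = 0 with derivative equal to 0. -/

import Mathlib

open MeasureTheory
open scoped RealInnerProductSpace BigOperators

noncomputable section

abbrev V2 : Type := EuclideanSpace ℝ (Fin 2)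

/-- standard basis vector of ℝ² -/
def e2 (j : Fin 2) : V2 := EuclideanSpace.single j 1

/-- Fourier transform with normalization `(2π)⁻¹ ∫ e^{-ik·x} ρ(x) dx`. -/
def FT (ρ : V2 → ℝ) (k : V2) : ℂ :=
  ((2 * Real.pi : ℝ) : ℂ)⁻¹ * ∫ x : V2, Complex.exp (-Complex.I * ((⟪k, x⟫ : ℝ) : ℂ)) * (ρ x : ℂ)

/-- j-th partial derivative of a complex-valued function on ℝ². -/
def pd (f : V2 → ℂ) (j : Fin 2) (k : V2) : ℂ := fderiv ℝ f k (e2 j)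

/-- `|∇f(k)|²` for a complex-valued function on ℝ². -/
def gradNormSqC (f : V2 → ℂ) (k : V2) : ℝ := ∑ j, ‖pd f j k‖ ^ 2

/-- `D(k) = |k|² - (v·k)²`. -/
def Dv (v : V2) (k : V2) : ℝ := ‖k‖ ^ 2 - (⟪v, k⟫ : ℝ) ^ 2

/-- `(J ∇f)_j` where `J` has rows `(0,1)`, `(-1,0)`. -/
def Jgrad (f : V2 → ℂ) (j : Fin 2) (k : V2) : ℂ := ![pd f 1 k, -pd f 0 k] j

/-- Fourier transform of the soliton field `A_{v,ω}`. -/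
def Ahat (ρ : V2 → ℝ) (v : V2) (ω : ℝ) (j : Fin 2) (k : V2) : ℂ :=
  (((v j - k j * (⟪v, k⟫ : ℝ) / ‖k‖ ^ 2 : ℝ) : ℂ) * FT ρ k
      - Complex.I * (ω : ℂ) * Jgrad (FT ρ) j k) / ((Dv v k : ℝ) : ℂ)

/-- The soliton field `A_{v,ω}` (inverse Fourier transform of `Ahat`). -/
def Asol (ρ : V2 → ℝ) (v : V2) (ω : ℝ) (j : Fin 2) (y : V2) : ℝ :=
  (((2 * Real.pi : ℝ) : ℂ)⁻¹ *
    ∫ k : V2, Complex.exp (Complex.I * ((⟪k, y⟫ : ℝ) : ℂ)) * Ahat ρ v ω j k).re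

/-- The soliton field `Π_{v,ω} = -(v·∇) A_{v,ω}`. -/
def Pisol (ρ : V2 → ℝ) (v : V2) (ω : ℝ) (j : Fin 2) (y : V2) : ℝ :=
  - fderiv ℝ (Asol ρ v ω j) y v

/-- `|∇A(y)|² = ∑_{i,j} (∂_i A_j(y))²`. -/
def gradSq (A : Fin 2 → V2 → ℝ) (y : V2) : ℝ :=
  ∑ i, ∑ j, (fderiv ℝ (A j) y (e2 i)) ^ 2

/-- Field energy `½∫ (|Π|² + |∇A|²)`. -/
def fieldEnergy (A Pf : Fin 2 → V2 → ℝ) : ℝ :=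
  (1 / 2) * ∫ y : V2, ((∑ j, (Pf j y) ^ 2) + gradSq A y)

/-- `⟨Π, ∇_* A⟩_j = ∫ Π(y)·∂_j A(y) dy`. -/
def momTerm (A Pf : Fin 2 → V2 → ℝ) (j : Fin 2) : ℝ :=
  ∫ y : V2, ∑ l, Pf l y * fderiv ℝ (A l) y (e2 j)

/-- `⟨A, ρ⟩_j = ∫ A_j(y) ρ(y) dy`. -/
def chargeTerm (ρ : V2 → ℝ) (A : Fin 2 → V2 → ℝ) (j : Fin 2) : ℝ :=
  ∫ y : V2, A j y * ρ y

/-- `∫ (Jy)·A(y) ρ(y) dy` where `(Jy) = (y₂, -y₁)`. -/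
def angTerm (ρ : V2 → ℝ) (A : Fin 2 → V2 → ℝ) : ℝ :=
  ∫ y : V2, (y 1 * A 0 y - y 0 * A 1 y) * ρ y

/-- The reduced Hamiltonian `H_{P,M}(A,Π)`. -/
def Hred (m I : ℝ) (ρ : V2 → ℝ) (P : Fin 2 → ℝ) (M : ℝ) (A Pf : Fin 2 → V2 → ℝ) : ℝ :=
  fieldEnergy A Pf
    + (1 / (2 * m)) * ∑ j, (P j + momTerm A Pf j - chargeTerm ρ A j) ^ 2
    + (1 / (2 * I)) * (M + angTerm ρ A) ^ 2

/-- The soliton linear momentum `P_{v,ω}`. -/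
def Psol (ρ : V2 → ℝ) (m : ℝ) (v : V2) (ω : ℝ) (j : Fin 2) : ℝ :=
  m * v j - momTerm (Asol ρ v ω) (Pisol ρ v ω) j + chargeTerm ρ (Asol ρ v ω) j

/-- The soliton angular momentum `M_{v,ω}`. -/
def Msol (ρ : V2 → ℝ) (I : ℝ) (v : V2) (ω : ℝ) : ℝ :=
  I * ω - angTerm ρ (Asol ρ v ω)

open scoped FourierTransform LineDeriv SchwartzMap

section FourierAnalysis

theorem integral_fourier_mul_eq_integral_mul_fourier {f g : V2 → ℂ}
    (hf : Integrable f) (hg : Integrable g) :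
    ∫ x, 𝓕 f x * g x = ∫ x, f x * 𝓕 g x := by
  have h := VectorFourier.integral_fourierIntegral_smul_eq_flip (μ := volume) (ν := volume)
    (L := innerₗ V2) (f := f) (g := g) Real.continuous_fourierChar
    continuous_inner hf hg
  rw [flip_innerₗ] at h
  exact h

theorem memLp_two_fourier {f : V2 → ℂ} (hf : Integrable f) (hf2 : MemLp f 2) :
    MemLp (𝓕 f) 2 := by
  set F : Lp ℂ 2 (volume : Measure V2) := hf2.toLp f with hF
  have hcont : Continuous (𝓕 f) :=
    VectorFourier.fourierIntegral_continuous Real.continuous_fourierChar continuous_inner hf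
  have key : ∀ᵐ x, (𝓕 F : Lp ℂ 2 (volume : Measure V2)) x = 𝓕 f x := by
    refine ae_eq_of_integral_contDiff_smul_eq
      ((Lp.memLp (𝓕 F)).locallyIntegrable (by norm_num)) hcont.locallyIntegrable ?_
    intro g hg hgc
    have hgc' : HasCompactSupport (fun x => (g x : ℂ)) :=
      hgc.comp_left (g := fun r : ℝ => (r : ℂ)) (by simp)
    let φ : 𝓢(V2, ℂ) := hgc'.toSchwartzMap (Complex.ofRealCLM.contDiff.comp hg)
    have hφ : ∀ x, φ x = (g x : ℂ) := fun _ => rfl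
    have h1 := DFunLike.congr_fun (Lp.fourier_toTemperedDistribution_eq F) φ
    rw [TemperedDistribution.fourier_apply, Lp.toTemperedDistribution_apply,
      Lp.toTemperedDistribution_apply] at h1
    have h2 : ∫ x, (𝓕 φ : 𝓢(V2, ℂ)) x • F x = ∫ x, (𝓕 φ : 𝓢(V2, ℂ)) x • f x :=
      integral_congr_ae (by filter_upwards [hf2.coeFn_toLp] with x hx; rw [hx])
    have h3 := integral_fourier_mul_eq_integral_mul_fourier hf φ.integrable
    calc ∫ x, g x • (𝓕 F : Lp ℂ 2 (volume : Measure V2)) x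
        = ∫ x, φ x • (𝓕 F : Lp ℂ 2 (volume : Measure V2)) x := by
          refine integral_congr_ae (ae_of_all _ fun x => ?_)
          simp [hφ]
      _ = ∫ x, 𝓕 f x * φ x := by
          rw [← h1, h2, h3]
          refine integral_congr_ae (ae_of_all _ fun x => ?_)
          simp [SchwartzMap.fourier_coe, mul_comm]
      _ = ∫ x, g x • 𝓕 f x := by
          refine integral_congr_ae (ae_of_all _ fun x => ?_)
          simp [hφ, mul_comm]
  exact (memLp_congr_ae key).1 (Lp.memLp (𝓕 F))

theorem fderiv_fourier_apply {f : V2 → ℂ} (hf : Integrable f)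
    (hf' : Integrable (fun ξ => ‖ξ‖ * ‖f ξ‖)) (y w : V2) :
    fderiv ℝ (𝓕 f) y w
      = 𝓕 (fun ξ => -(2 * Real.pi * Complex.I) * ((⟪ξ, w⟫ : ℝ) : ℂ) * f ξ) y := by
  rw [Real.fderiv_fourier hf hf', Real.fourier_eq, Real.fourier_eq,
    ContinuousLinearMap.integral_apply]
  · refine integral_congr_ae (ae_of_all _ fun ξ => ?_)
    change Real.fourierChar _ • (-(2 * Real.pi * Complex.I) • ((⟪ξ, w⟫ : ℝ) • f ξ)) = _
    simp [mul_assoc]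
  · refine (Real.fourierIntegral_convergent_iff y).2 ?_
    refine (hf'.const_mul (2 * Real.pi)).mono' hf.1.fourierSMulRight (ae_of_all _ fun ξ => ?_)
    refine (VectorFourier.norm_fourierSMulRight_le _ _ _).trans ?_
    have : ‖(innerSL ℝ : V2 →L[ℝ] V2 →L[ℝ] ℝ)‖ ≤ 1 := norm_innerSL_le ℝ
    have h0 : 0 ≤ 2 * Real.pi := by positivity
    nlinarith [mul_nonneg (mul_nonneg h0 (norm_nonneg ξ)) (norm_nonneg (f ξ))]

theorem integrable_inner_mul {f : V2 → ℂ} (hf : Integrable f)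
    (hf' : Integrable (fun ξ => ‖ξ‖ * ‖f ξ‖)) (c : ℂ) (w : V2) :
    Integrable (fun ξ => c * ((⟪ξ, w⟫ : ℝ) : ℂ) * f ξ) := by
  refine (hf'.const_mul (‖c‖ * ‖w‖)).mono' ?_ (ae_of_all _ fun ξ => ?_)
  · exact (Continuous.aestronglyMeasurable (by fun_prop)).mul hf.1
  · have := norm_inner_le_norm (𝕜 := ℝ) ξ w
    rw [norm_mul, norm_mul, Complex.norm_real]
    calc ‖c‖ * ‖(⟪ξ, w⟫ : ℝ)‖ * ‖f ξ‖ ≤ ‖c‖ * (‖ξ‖ * ‖w‖) * ‖f ξ‖ := by gcongr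
      _ = _ := by ring

theorem memLp_inner_mul {f : V2 → ℂ} (hf : Integrable f)
    (hf' : MemLp (fun ξ => ‖ξ‖ * ‖f ξ‖) 2) (c : ℂ) (w : V2) :
    MemLp (fun ξ => c * ((⟪ξ, w⟫ : ℝ) : ℂ) * f ξ) 2 := by
  refine (hf'.const_mul (‖c‖ * ‖w‖)).mono ?_ (ae_of_all _ fun ξ => ?_)
  · exact (Continuous.aestronglyMeasurable (by fun_prop)).mul hf.1
  · have := norm_inner_le_norm (𝕜 := ℝ) ξ w
    rw [norm_mul, norm_mul, Complex.norm_real]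
    refine le_trans ?_ (le_abs_self _)
    calc ‖c‖ * ‖(⟪ξ, w⟫ : ℝ)‖ * ‖f ξ‖ ≤ ‖c‖ * (‖ξ‖ * ‖w‖) * ‖f ξ‖ := by gcongr
      _ = _ := by ring

theorem fderiv_re_apply {u : V2 → ℂ} {y : V2} (hu : DifferentiableAt ℝ u y) (w : V2) :
    fderiv ℝ (fun y => (u y).re) y w = (fderiv ℝ u y w).re := by
  have := (Complex.reCLM.hasFDerivAt.comp y hu.hasFDerivAt).fderiv
  have h2 : (Complex.reCLM ∘ u) = fun y => (u y).re := rfl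
  rw [h2] at this
  rw [this]; rfl

/-- A real Schwartz function regarded as a complex one. -/
def toComplexSchwartz (a : 𝓢(V2, ℝ)) : 𝓢(V2, ℂ) :=
  SchwartzMap.postcompCLM (𝕜 := ℝ) Complex.ofRealCLM a

@[simp]
theorem toComplexSchwartz_apply (a : 𝓢(V2, ℝ)) (x : V2) : toComplexSchwartz a x = (a x : ℂ) := rfl

theorem lineDeriv_toComplexSchwartz (a : 𝓢(V2, ℝ)) (w x : V2) :
    (∂_{w} (toComplexSchwartz a) : 𝓢(V2, ℂ)) x = (fderiv ℝ a x w : ℂ) := by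
  rw [SchwartzMap.lineDerivOp_apply_eq_fderiv]
  have h2 : (Complex.ofRealCLM ∘ a) = ⇑(toComplexSchwartz a) := rfl
  rw [← h2, (Complex.ofRealCLM.hasFDerivAt.comp x a.differentiableAt.hasFDerivAt).fderiv]
  rfl

theorem fourier_lineDeriv_apply (φ : 𝓢(V2, ℂ)) (w ξ : V2) :
    (𝓕 (∂_{w} φ) : 𝓢(V2, ℂ)) ξ
      = 2 * Real.pi * Complex.I * (((⟪ξ, w⟫ : ℝ) : ℂ) * (𝓕 φ : 𝓢(V2, ℂ)) ξ) := by
  rw [SchwartzMap.fourier_lineDerivOp_eq]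
  have : (fun x : V2 => (inner ℝ x w : ℝ)).HasTemperateGrowth := by fun_prop
  simp [SchwartzMap.smulLeftCLM_apply_apply this]

theorem integral_fderiv_re_fourier_mul_fderiv {f : V2 → ℂ} (hf : Integrable f)
    (hf' : Integrable (fun ξ => ‖ξ‖ * ‖f ξ‖)) (a : 𝓢(V2, ℝ)) (w : V2) :
    ∫ y, fderiv ℝ (fun y => (𝓕 f y).re) y w * fderiv ℝ a y w
      = (∫ ξ, (4 * Real.pi ^ 2 * (⟪ξ, w⟫ : ℝ) ^ 2 : ℂ) * f ξ
          * (𝓕 (toComplexSchwartz a) : 𝓢(V2, ℂ)) ξ).re := by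
  have hI := integrable_inner_mul hf hf' (-(2 * Real.pi * Complex.I)) w
  have h := integral_fourier_mul_eq_integral_mul_fourier hI
    (∂_{w} (toComplexSchwartz a) : 𝓢(V2, ℂ)).integrable
  have h1 : ∀ y, fderiv ℝ (fun y => (𝓕 f y).re) y w * fderiv ℝ a y w
      = (𝓕 (fun ξ => -(2 * Real.pi * Complex.I) * ((⟪ξ, w⟫ : ℝ) : ℂ) * f ξ) y
        * (∂_{w} (toComplexSchwartz a) : 𝓢(V2, ℂ)) y).re := by
    intro y
    rw [fderiv_re_apply (Real.differentiable_fourier hf hf' y), fderiv_fourier_apply hf hf',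
      lineDeriv_toComplexSchwartz, Complex.re_mul_ofReal]
  simp_rw [h1]
  have h2 : Integrable (fun y =>
      𝓕 (fun ξ => -(2 * Real.pi * Complex.I) * ((⟪ξ, w⟫ : ℝ) : ℂ) * f ξ) y
        * (∂_{w} (toComplexSchwartz a) : 𝓢(V2, ℂ)) y) := by
    refine Integrable.bdd_mul (∂_{w} (toComplexSchwartz a) : 𝓢(V2, ℂ)).integrable
      (c := ∫ ξ, ‖-(2 * Real.pi * Complex.I) * ((⟪ξ, w⟫ : ℝ) : ℂ) * f ξ‖) ?_
      (ae_of_all _ fun y => ?_)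
    · exact (VectorFourier.fourierIntegral_continuous Real.continuous_fourierChar
        continuous_inner hI).aestronglyMeasurable
    · exact VectorFourier.norm_fourierIntegral_le_integral_norm _ _ _ _ _
  have h3 := integral_re (𝕜 := ℂ) h2
  simp only [RCLike.re_to_complex] at h3
  rw [h3, h]
  congr 1
  refine integral_congr_ae (ae_of_all _ fun ξ => ?_)
  have h4 := fourier_lineDeriv_apply (toComplexSchwartz a) w ξ
  rw [SchwartzMap.fourier_coe] at h4
  simp only [h4]
  linear_combination (-4 * Real.pi ^ 2 * ((⟪ξ, w⟫ : ℝ) : ℂ) ^ 2 * f ξ *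
    (𝓕 (toComplexSchwartz a) : 𝓢(V2, ℂ)) ξ) * Complex.I_sq

end FourierAnalysis

section Decay

theorem integrable_inv_one_add_norm_pow_four {E : Type*} [NormedAddCommGroup E] [NormedSpace ℝ E]
    [FiniteDimensional ℝ E] [MeasurableSpace E] [BorelSpace E] (μ : Measure E)
    [μ.IsAddHaarMeasure] (h : Module.finrank ℝ E < 4) :
    Integrable (fun x : E => ((1 + ‖x‖) ^ 4)⁻¹) μ := by
  have h1 : (Module.finrank ℝ E : ℝ) < (4 : ℝ) := by exact_mod_cast h
  refine (integrable_one_add_norm (μ := μ) h1).congr (ae_of_all _ fun x => ?_)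
  have hx : 0 ≤ 1 + ‖x‖ := by positivity
  simp only [Real.rpow_neg hx]
  norm_cast

theorem integrable_inv_norm_mul_inv_one_add_norm_pow_four :
    Integrable (fun ξ : V2 => ‖ξ‖⁻¹ * ((1 + ‖ξ‖) ^ 4)⁻¹) := by
  have h := (integrable_fun_norm_addHaar (volume : Measure V2)
    (f := fun y : ℝ => y⁻¹ * ((1 + y) ^ 4)⁻¹)).2
  apply h
  have h1 := (integrable_inv_one_add_norm_pow_four (volume : Measure ℝ) (by simp)).integrableOn
    (s := Set.Ioi 0)
  refine h1.congr_fun (fun y hy => ?_) measurableSet_Ioi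
  have hy : 0 < y := hy
  simp only [finrank_euclideanSpace, Fintype.card_fin, Real.norm_eq_abs, abs_of_pos hy,
    smul_eq_mul]
  norm_num
  field_simp

variable {f : V2 → ℂ} {C : ℝ}

theorem integrable_of_norm_mul_le (hf : AEStronglyMeasurable f)
    (hC : ∀ ξ, ‖ξ‖ * ‖f ξ‖ ≤ C * ((1 + ‖ξ‖) ^ 4)⁻¹) : Integrable f := by
  refine (integrable_inv_norm_mul_inv_one_add_norm_pow_four.const_mul C).mono' hf ?_
  filter_upwards [compl_mem_ae_iff.2 (measure_singleton (0 : V2))] with ξ hξ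
  have hξ : 0 < ‖ξ‖ := norm_pos_iff.2 hξ
  have := hC ξ
  calc ‖f ξ‖ = ‖ξ‖⁻¹ * (‖ξ‖ * ‖f ξ‖) := by field_simp
    _ ≤ ‖ξ‖⁻¹ * (C * ((1 + ‖ξ‖) ^ 4)⁻¹) := by gcongr
    _ = _ := by ring

theorem integrable_norm_mul_of_norm_mul_le (hf : AEStronglyMeasurable f)
    (hC : ∀ ξ, ‖ξ‖ * ‖f ξ‖ ≤ C * ((1 + ‖ξ‖) ^ 4)⁻¹) :
    Integrable (fun ξ => ‖ξ‖ * ‖f ξ‖) := by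
  refine ((integrable_inv_one_add_norm_pow_four (volume : Measure V2) (by simp)).const_mul C).mono'
    (continuous_norm.aestronglyMeasurable.mul hf.norm) (ae_of_all _ fun ξ => ?_)
  rw [Real.norm_of_nonneg (by positivity)]
  exact hC ξ

theorem memLp_norm_mul_of_norm_mul_le (hf : AEStronglyMeasurable f)
    (hC : ∀ ξ, ‖ξ‖ * ‖f ξ‖ ≤ C * ((1 + ‖ξ‖) ^ 4)⁻¹) :
    MemLp (fun ξ => ‖ξ‖ * ‖f ξ‖) 2 := by
  have hm : AEStronglyMeasurable (fun ξ : V2 => ‖ξ‖ * ‖f ξ‖) :=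
    continuous_norm.aestronglyMeasurable.mul hf.norm
  refine (memLp_two_iff_integrable_sq hm).2 ?_
  refine ((integrable_inv_one_add_norm_pow_four (volume : Measure V2)
    (by simp)).const_mul (C ^ 2)).mono' (hm.pow 2) (ae_of_all _ fun ξ => ?_)
  have h1 : ((1 + ‖ξ‖) ^ 4)⁻¹ ≤ 1 := inv_le_one_of_one_le₀ (one_le_pow₀ (by simp))
  have h0 : 0 ≤ ((1 + ‖ξ‖) ^ 4)⁻¹ := by positivity
  rw [Real.norm_of_nonneg (by positivity)]
  calc (‖ξ‖ * ‖f ξ‖) ^ 2 ≤ (C * ((1 + ‖ξ‖) ^ 4)⁻¹) ^ 2 :=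
        pow_le_pow_left₀ (by positivity) (hC ξ) 2
    _ = C ^ 2 * (((1 + ‖ξ‖) ^ 4)⁻¹ * ((1 + ‖ξ‖) ^ 4)⁻¹) := by ring
    _ ≤ C ^ 2 * (((1 + ‖ξ‖) ^ 4)⁻¹ * 1) := by gcongr
    _ = _ := by ring

theorem schwartz_norm_le_of_apply_zero {E : Type*} [NormedAddCommGroup E] [NormedSpace ℝ E]
    (f : 𝓢(V2, E)) (h0 : f 0 = 0) :
    ∃ C, 0 ≤ C ∧ ∀ ξ, ‖f ξ‖ ≤ C * ‖ξ‖ * ((1 + ‖ξ‖) ^ 4)⁻¹ := by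
  obtain ⟨L, hL0, hL⟩ := f.decay 0 1
  set K : ℝ := 2 ^ 4 * (Finset.Iic ((4, 0) : ℕ × ℕ)).sup
    (fun m => SchwartzMap.seminorm ℝ m.1 m.2) f with hK
  have hK0 : 0 ≤ K := by positivity
  refine ⟨2 ^ 4 * L + K, by positivity, fun ξ => ?_⟩
  have h1 : (1 + ‖ξ‖) ^ 4 * ‖f ξ‖ ≤ K := by
    simpa using SchwartzMap.one_add_le_sup_seminorm_apply (𝕜 := ℝ) (m := (4, 0)) (k := 4) (n := 0)
      le_rfl le_rfl f ξ
  have h2 : ‖f ξ‖ ≤ L * ‖ξ‖ := by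
    have := Convex.norm_image_sub_le_of_norm_fderiv_le (𝕜 := ℝ) (f := f) (C := L) (x := 0) (y := ξ)
      (s := Set.univ) (fun x _ => f.differentiableAt)
      (fun x _ => by simpa [norm_iteratedFDeriv_one] using hL x) convex_univ trivial trivial
    simpa [h0] using this
  rw [← div_eq_mul_inv, le_div_iff₀ (by positivity)]
  rcases le_total ‖ξ‖ 1 with h | h
  · have h3 : (1 + ‖ξ‖) ^ 4 ≤ 2 ^ 4 := by gcongr; linarith
    calc ‖f ξ‖ * (1 + ‖ξ‖) ^ 4 ≤ (L * ‖ξ‖) * 2 ^ 4 := by gcongr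
      _ ≤ (2 ^ 4 * L + K) * ‖ξ‖ := by nlinarith [mul_nonneg hK0 (norm_nonneg ξ)]
  · calc ‖f ξ‖ * (1 + ‖ξ‖) ^ 4 ≤ K := by linarith
      _ ≤ (2 ^ 4 * L + K) * ‖ξ‖ := by nlinarith [mul_nonneg hL0.le (norm_nonneg ξ)]

end Decay

section SolitonFourier

variable (ρ : 𝓢(V2, ℝ)) (v : V2) (ω : ℝ)

/-- The inverse Fourier transform of the charge density, in the normalization of Mathlib. -/
def invFT : 𝓢(V2, ℂ) := 𝓕⁻ (toComplexSchwartz ρ)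

/-- The Fourier profile of the soliton field: `A_{v,ω}` is the real part of its Fourier transform
in the normalization of Mathlib. -/
def solProfile (j : Fin 2) (ξ : V2) : ℂ :=
  2 * Real.pi * Ahat ρ v ω j (-(2 * Real.pi) • ξ)

theorem invFT_apply (ξ : V2) :
    invFT ρ ξ = ∫ x, Complex.exp (2 * Real.pi * (⟪x, ξ⟫ : ℝ) * Complex.I) * (ρ x : ℂ) := by
  rw [invFT, SchwartzMap.fourierInv_coe, Real.fourierInv_eq']
  simp

theorem FT_eq_invFT (k : V2) :
    FT ρ k = (2 * Real.pi : ℂ)⁻¹ * invFT ρ (-(2 * Real.pi)⁻¹ • k) := by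
  rw [FT, invFT_apply]
  push_cast
  congr 2
  ext x
  congr 2
  rw [inner_smul_right, real_inner_comm]
  push_cast
  have : (Real.pi : ℂ) ≠ 0 := by exact_mod_cast Real.pi_ne_zero
  field_simp

theorem pd_FT (j : Fin 2) (ξ : V2) :
    pd (FT ρ) j (-(2 * Real.pi) • ξ) = -((2 * Real.pi : ℂ)⁻¹) ^ 2 * pd (invFT ρ) j ξ := by
  have hπ : Real.pi ≠ 0 := Real.pi_ne_zero
  have h1 : FT ρ = fun k => (2 * Real.pi : ℂ)⁻¹ * invFT ρ (-(2 * Real.pi)⁻¹ • k) :=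
    funext (FT_eq_invFT ρ)
  have hL : HasFDerivAt (fun k : V2 => -(2 * Real.pi)⁻¹ • k)
      (-(2 * Real.pi)⁻¹ • ContinuousLinearMap.id ℝ V2) (-(2 * Real.pi) • ξ) :=
    (-(2 * Real.pi)⁻¹ • ContinuousLinearMap.id ℝ V2).hasFDerivAt
  have hp : -(2 * Real.pi)⁻¹ • (-(2 * Real.pi) • ξ) = ξ := by
    rw [smul_smul]
    have : -(2 * Real.pi)⁻¹ * -(2 * Real.pi) = 1 := by field_simp
    rw [this, one_smul]
  have hR : HasFDerivAt (invFT ρ) (fderiv ℝ (invFT ρ) ξ)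
      (-(2 * Real.pi)⁻¹ • (-(2 * Real.pi) • ξ)) := by
    rw [hp]; exact (invFT ρ).hasFDerivAt ξ
  have := ((hR.comp _ hL).const_mul ((2 * Real.pi : ℂ)⁻¹)).fderiv
  simp only [Function.comp_def] at this
  rw [pd, h1, this, pd]
  simp
  ring

theorem solProfile_eq (j : Fin 2) (ξ : V2) :
    solProfile ρ v ω j ξ =
      (((v j - ξ j * (⟪v, ξ⟫ : ℝ) / ‖ξ‖ ^ 2 : ℝ) : ℂ) * invFT ρ ξ
        + Complex.I * (ω : ℂ) * (2 * Real.pi : ℂ)⁻¹ * Jgrad (invFT ρ) j ξ)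
        / ((4 * Real.pi ^ 2 * Dv v ξ : ℝ) : ℂ) := by
  have hπ : Real.pi ≠ 0 := Real.pi_ne_zero
  have hπc : (Real.pi : ℂ) ≠ 0 := by exact_mod_cast hπ
  have hp : -(2 * Real.pi)⁻¹ • (-(2 * Real.pi) • ξ) = ξ := by
    rw [smul_smul]
    have : -(2 * Real.pi)⁻¹ * -(2 * Real.pi) = 1 := by field_simp
    rw [this, one_smul]
  have hJ : Jgrad (FT ρ) j (-(2 * Real.pi) • ξ)
      = -((2 * Real.pi : ℂ)⁻¹) ^ 2 * Jgrad (invFT ρ) j ξ := by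
    fin_cases j <;> simp only [Jgrad, pd_FT] <;> simp
  have hD : Dv v (-(2 * Real.pi) • ξ) = 4 * Real.pi ^ 2 * Dv v ξ := by
    simp only [Dv, norm_smul, inner_smul_right, mul_pow, Real.norm_eq_abs, sq_abs]
    ring
  have hc : (-(2 * Real.pi) • ξ) j * ⟪v, -(2 * Real.pi) • ξ⟫ / ‖-(2 * Real.pi) • ξ‖ ^ 2
      = ξ j * ⟪v, ξ⟫ / ‖ξ‖ ^ 2 := by
    simp only [norm_smul, inner_smul_right, mul_pow, Real.norm_eq_abs, sq_abs, PiLp.smul_apply,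
      smul_eq_mul]
    rw [show -(2 * Real.pi) * ξ j * (-(2 * Real.pi) * ⟪v, ξ⟫)
      = (-(2 * Real.pi)) ^ 2 * (ξ j * ⟪v, ξ⟫) by ring]
    exact mul_div_mul_left _ _ (pow_ne_zero 2 (by simp [hπ]))
  rw [solProfile, Ahat, hJ, hD, hc, FT_eq_invFT, hp, ← mul_div_assoc]
  congr 1
  field_simp
  ring

theorem Asol_eq_re_fourier (j : Fin 2) :
    Asol ρ v ω j = fun y => (𝓕 (solProfile ρ v ω j) y).re := by
  ext y
  rw [Asol, Real.fourier_eq']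
  congr 1
  have h := Measure.integral_comp_smul (volume : Measure V2)
    (fun k : V2 => Complex.exp (Complex.I * ((⟪k, y⟫ : ℝ) : ℂ)) * Ahat ρ v ω j k)
    (-(2 * Real.pi))
  have hπ : Real.pi ≠ 0 := Real.pi_ne_zero
  have hπc : (Real.pi : ℂ) ≠ 0 := by exact_mod_cast hπ
  have h2 : ∫ ξ : V2, Complex.exp (↑(-2 * Real.pi * ⟪ξ, y⟫) * Complex.I) • solProfile ρ v ω j ξ
      = 2 * Real.pi * ∫ ξ : V2, Complex.exp (Complex.I * ((⟪-(2 * Real.pi) • ξ, y⟫ : ℝ) : ℂ))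
        * Ahat ρ v ω j (-(2 * Real.pi) • ξ) := by
    rw [← integral_const_mul]
    refine integral_congr_ae (ae_of_all _ fun ξ => ?_)
    simp only [solProfile, real_inner_smul_left, smul_eq_mul]
    rw [show Complex.I * ((-(2 * Real.pi) * ⟪ξ, y⟫ : ℝ) : ℂ)
      = ((-2 * Real.pi * ⟪ξ, y⟫ : ℝ) : ℂ) * Complex.I by push_cast; ring]
    ring
  rw [h2, h]
  have h3 : |(-(2 * Real.pi)) ^ 2|⁻¹ = ((2 * Real.pi) ^ 2)⁻¹ := by rw [neg_sq, abs_sq]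
  simp only [finrank_euclideanSpace, Fintype.card_fin, abs_inv, h3, Complex.real_smul]
  push_cast
  field_simp

end SolitonFourier

section SolitonDecay

variable (ρ : 𝓢(V2, ℝ)) (v : V2) (ω : ℝ)

theorem invFT_neg (hρ : ∀ x, ρ (-x) = ρ x) (ξ : V2) : invFT ρ (-ξ) = invFT ρ ξ := by
  rw [invFT_apply, invFT_apply, ← integral_neg_eq_self]
  simp [hρ]

theorem invFT_zero (hρ : ∫ x, ρ x = 0) : invFT ρ 0 = 0 := by
  rw [invFT_apply]
  simp only [inner_zero_right, Complex.ofReal_zero, mul_zero, zero_mul, Complex.exp_zero, one_mul]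
  rw [integral_complex_ofReal, hρ, Complex.ofReal_zero]

theorem fderiv_invFT_zero (hρ : ∀ x, ρ (-x) = ρ x) : fderiv ℝ (invFT ρ) 0 = 0 := by
  have h1 : (fun ξ => invFT ρ (-ξ)) = invFT ρ := funext (invFT_neg ρ hρ)
  have hR : HasFDerivAt (invFT ρ) (fderiv ℝ (invFT ρ) 0) (-0) := by
    rw [neg_zero]; exact (invFT ρ).hasFDerivAt 0
  have h2 := (hR.comp 0 (hasFDerivAt_id (0 : V2)).neg).fderiv
  simp only [Function.comp_def] at h2
  ext x
  have h3 := DFunLike.congr_fun h2 x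
  simp only [h1] at h3
  simpa [self_eq_neg] using h3

theorem norm_e2 (j : Fin 2) : ‖e2 j‖ = 1 := by simp [e2]

theorem norm_Jgrad_le (f : V2 → ℂ) (j : Fin 2) (ξ : V2) : ‖Jgrad f j ξ‖ ≤ ‖fderiv ℝ f ξ‖ := by
  have h : ∀ i, ‖pd f i ξ‖ ≤ ‖fderiv ℝ f ξ‖ := fun i => by
    simpa [norm_e2, pd] using (fderiv ℝ f ξ).le_opNorm (e2 i)
  fin_cases j
  · simpa [Jgrad] using h 1
  · simpa [Jgrad] using h 0

theorem mul_norm_sq_le_Dv (ξ : V2) : (1 - ‖v‖ ^ 2) * ‖ξ‖ ^ 2 ≤ Dv v ξ := by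
  have := pow_le_pow_left₀ (abs_nonneg _) (abs_real_inner_le_norm v ξ) 2
  rw [sq_abs, mul_pow] at this
  rw [Dv]; linarith

theorem abs_coord_le (ξ : V2) (j : Fin 2) : |ξ j| ≤ ‖ξ‖ := by
  simpa using PiLp.norm_apply_le ξ j

theorem abs_transverse_le (hv : ‖v‖ < 1) (j : Fin 2) (ξ : V2) :
    |v j - ξ j * ⟪v, ξ⟫ / ‖ξ‖ ^ 2| ≤ 2 := by
  have h1 : |v j| ≤ 1 := (abs_coord_le v j).trans hv.le
  have h2 : |ξ j * ⟪v, ξ⟫ / ‖ξ‖ ^ 2| ≤ 1 := by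
    rw [abs_div, abs_mul, abs_of_nonneg (by positivity : 0 ≤ ‖ξ‖ ^ 2)]
    refine div_le_one_of_le₀ ?_ (by positivity)
    have h3 : |⟪v, ξ⟫| ≤ 1 * ‖ξ‖ := (abs_real_inner_le_norm v ξ).trans (by gcongr)
    calc |ξ j| * |⟪v, ξ⟫| ≤ ‖ξ‖ * (1 * ‖ξ‖) := by gcongr; exact abs_coord_le ξ j
      _ = _ := by ring
  calc _ ≤ |v j| + |ξ j * ⟪v, ξ⟫ / ‖ξ‖ ^ 2| := abs_sub _ _
    _ ≤ 2 := by linarith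

theorem exists_norm_mul_solProfile_le (hv : ‖v‖ < 1) (hneg : ∀ x, ρ (-x) = ρ x)
    (hneu : ∫ x, ρ x = 0) (j : Fin 2) :
    ∃ C, ∀ ξ, ‖ξ‖ * ‖solProfile ρ v ω j ξ‖ ≤ C * ((1 + ‖ξ‖) ^ 4)⁻¹ := by
  obtain ⟨C₁, hC₁, h₁⟩ := schwartz_norm_le_of_apply_zero (invFT ρ) (invFT_zero ρ hneu)
  obtain ⟨C₂, hC₂, h₂⟩ := schwartz_norm_le_of_apply_zero
    (SchwartzMap.fderivCLM ℝ V2 ℂ (invFT ρ)) (fderiv_invFT_zero ρ hneg)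
  have hπ := Real.pi_pos
  have hv' : 0 < 1 - ‖v‖ ^ 2 := by nlinarith [norm_nonneg v]
  refine ⟨(2 * C₁ + |ω| * (2 * Real.pi)⁻¹ * C₂) / (4 * Real.pi ^ 2 * (1 - ‖v‖ ^ 2)), fun ξ => ?_⟩
  have hK : 0 ≤ (2 * C₁ + |ω| * (2 * Real.pi)⁻¹ * C₂) / (4 * Real.pi ^ 2 * (1 - ‖v‖ ^ 2)) := by
    positivity
  by_cases hξ : ξ = 0
  · rw [hξ, norm_zero, zero_mul]; positivity
  have hξ : 0 < ‖ξ‖ := norm_pos_iff.2 hξ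
  have hD := mul_norm_sq_le_Dv v ξ
  have hD0 : 0 < (1 - ‖v‖ ^ 2) * ‖ξ‖ ^ 2 := by positivity
  have hnum : ‖((v j - ξ j * (⟪v, ξ⟫ : ℝ) / ‖ξ‖ ^ 2 : ℝ) : ℂ) * invFT ρ ξ
        + Complex.I * (ω : ℂ) * (2 * Real.pi : ℂ)⁻¹ * Jgrad (invFT ρ) j ξ‖
      ≤ (2 * C₁ + |ω| * (2 * Real.pi)⁻¹ * C₂) * (‖ξ‖ * ((1 + ‖ξ‖) ^ 4)⁻¹) := by
    have e1 := abs_transverse_le v hv j ξ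
    have e2 : ‖Jgrad (invFT ρ) j ξ‖ ≤ C₂ * ‖ξ‖ * ((1 + ‖ξ‖) ^ 4)⁻¹ :=
      (norm_Jgrad_le _ j ξ).trans (h₂ ξ)
    have e3 : ‖Complex.I * (ω : ℂ) * (2 * Real.pi : ℂ)⁻¹‖ = |ω| * (2 * Real.pi)⁻¹ := by
      simp [abs_of_pos hπ]
    refine (norm_add_le _ _).trans ?_
    rw [norm_mul, norm_mul _ (Jgrad _ _ _), e3, Complex.norm_real, Real.norm_eq_abs]
    calc _ ≤ 2 * (C₁ * ‖ξ‖ * ((1 + ‖ξ‖) ^ 4)⁻¹)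
          + |ω| * (2 * Real.pi)⁻¹ * (C₂ * ‖ξ‖ * ((1 + ‖ξ‖) ^ 4)⁻¹) := by
            gcongr; exact h₁ ξ
      _ = _ := by ring
  rw [solProfile_eq, norm_div, Complex.norm_real, Real.norm_of_nonneg
    (mul_nonneg (by positivity) (hD0.le.trans hD))]
  calc _ ≤ ‖ξ‖ * ((2 * C₁ + |ω| * (2 * Real.pi)⁻¹ * C₂) * (‖ξ‖ * ((1 + ‖ξ‖) ^ 4)⁻¹)
        / (4 * Real.pi ^ 2 * ((1 - ‖v‖ ^ 2) * ‖ξ‖ ^ 2))) := by gcongr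
    _ = _ := by field_simp

theorem continuous_pd (f : 𝓢(V2, ℂ)) (j : Fin 2) : Continuous (pd f j) :=
  (∂_{e2 j} f : 𝓢(V2, ℂ)).continuous

theorem continuous_Jgrad (f : 𝓢(V2, ℂ)) (j : Fin 2) : Continuous (Jgrad f j) := by
  fin_cases j
  · exact continuous_pd f 1
  · exact (continuous_pd f 0).neg

theorem aestronglyMeasurable_solProfile (j : Fin 2) :
    AEStronglyMeasurable (solProfile ρ v ω j) := by
  have h1 := (invFT ρ).continuous.measurable
  have h2 := (continuous_Jgrad (invFT ρ) j).measurable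
  have h3 : Measurable (fun ξ : V2 => ξ j) := (PiLp.continuous_apply 2 _ j).measurable
  have h4 : Measurable (fun ξ : V2 => ⟪v, ξ⟫) := by fun_prop
  have h : solProfile ρ v ω j = _ := funext (solProfile_eq ρ v ω j)
  rw [h]
  unfold Dv
  exact Measurable.aestronglyMeasurable (by fun_prop)

end SolitonDecay

section WeakEquation

theorem integrable_inner_sq_mul_fourier {f : V2 → ℂ} (hf : Integrable f)
    (hf' : Integrable (fun ξ => ‖ξ‖ * ‖f ξ‖)) (a : 𝓢(V2, ℝ)) (w : V2) :
    Integrable (fun ξ => (4 * Real.pi ^ 2 * (⟪ξ, w⟫ : ℝ) ^ 2 : ℂ) * f ξ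
      * (𝓕 (toComplexSchwartz a) : 𝓢(V2, ℂ)) ξ) := by
  set φ : 𝓢(V2, ℂ) := 𝓕 (∂_{w} (toComplexSchwartz a)) with hφ
  have hI := integrable_inner_mul hf hf' (-(2 * Real.pi * Complex.I)) w
  obtain ⟨K, -, hK⟩ := φ.decay 0 0
  have h : Integrable (fun ξ => φ ξ * (-(2 * Real.pi * Complex.I) * ((⟪ξ, w⟫ : ℝ) : ℂ) * f ξ)) :=
    hI.bdd_mul φ.continuous.aestronglyMeasurable (c := K)
      (ae_of_all _ fun ξ => by simpa using hK ξ)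
  refine h.congr (ae_of_all _ fun ξ => ?_)
  simp only [hφ, fourier_lineDeriv_apply]
  linear_combination (-4 * Real.pi ^ 2 * ((⟪ξ, w⟫ : ℝ) : ℂ) ^ 2 * f ξ *
    (𝓕 (toComplexSchwartz a) : 𝓢(V2, ℂ)) ξ) * Complex.I_sq

theorem integral_fourierInv_mul_fourier (f g : 𝓢(V2, ℂ)) :
    ∫ ξ, (𝓕⁻ f : 𝓢(V2, ℂ)) ξ * (𝓕 g : 𝓢(V2, ℂ)) ξ = ∫ x, f x * g x := by
  have h := integral_fourier_mul_eq_integral_mul_fourier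
    (𝓕⁻ f : 𝓢(V2, ℂ)).integrable g.integrable
  rw [← SchwartzMap.fourier_coe, ← SchwartzMap.fourier_coe, FourierTransform.fourier_fourierInv_eq]
    at h
  exact h.symm

theorem inner_e2 (ξ : V2) (j : Fin 2) : (⟪ξ, e2 j⟫ : ℝ) = ξ j := by
  rw [e2, EuclideanSpace.inner_single_right]
  simp

theorem integral_invFT_mul_fourier (ρ a : 𝓢(V2, ℝ)) :
    ∫ ξ, invFT ρ ξ * (𝓕 (toComplexSchwartz a) : 𝓢(V2, ℂ)) ξ = ((∫ y, a y * ρ y : ℝ) : ℂ) := by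
  rw [invFT, integral_fourierInv_mul_fourier, ← integral_complex_ofReal]
  exact integral_congr_ae (ae_of_all _ fun y => by simp [mul_comm])

theorem integral_pd_invFT_mul_fourier (ρ a : 𝓢(V2, ℝ)) (k : Fin 2) :
    ∫ ξ, pd (invFT ρ) k ξ * (𝓕 (toComplexSchwartz a) : 𝓢(V2, ℂ)) ξ
      = 2 * Real.pi * Complex.I * ((∫ y, y k * a y * ρ y : ℝ) : ℂ) := by
  have h : ∀ ξ, pd (invFT ρ) k ξ = (∂_{e2 k} (𝓕⁻ (toComplexSchwartz ρ)) : 𝓢(V2, ℂ)) ξ :=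
    fun _ => rfl
  simp_rw [h]
  rw [SchwartzMap.lineDerivOp_fourierInv_eq, integral_fourierInv_mul_fourier,
    ← integral_complex_ofReal, ← integral_const_mul]
  refine integral_congr_ae (ae_of_all _ fun y => ?_)
  have ht : (fun x : V2 => (inner ℝ x (e2 k) : ℝ)).HasTemperateGrowth := by fun_prop
  dsimp only
  rw [smul_apply, SchwartzMap.smulLeftCLM_apply_apply ht, inner_e2]
  simp only [toComplexSchwartz_apply, smul_eq_mul, Complex.real_smul]
  push_cast
  ring

theorem sum_coord_mul_fourier_eq_zero (a : Fin 2 → 𝓢(V2, ℝ))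
    (hdiv : ∀ y, ∑ j, fderiv ℝ (a j) y (e2 j) = 0) (ξ : V2) :
    ∑ j, (ξ j : ℂ) * (𝓕 (toComplexSchwartz (a j)) : 𝓢(V2, ℂ)) ξ = 0 := by
  have h : ∑ j, (∂_{e2 j} (toComplexSchwartz (a j)) : 𝓢(V2, ℂ)) = 0 := by
    ext y
    simp only [sum_apply, lineDeriv_toComplexSchwartz, zero_apply]
    exact_mod_cast hdiv y
  have h2 : ∑ j, (𝓕 (∂_{e2 j} (toComplexSchwartz (a j))) : 𝓢(V2, ℂ)) ξ = 0 := by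
    rw [← sum_apply, ← FourierTransform.fourier_sum, h, FourierTransform.fourier_zero, zero_apply]
  simp only [fourier_lineDeriv_apply, inner_e2, ← Finset.mul_sum] at h2
  have hπ : (2 * Real.pi * Complex.I : ℂ) ≠ 0 := by simp [Real.pi_ne_zero]
  exact (mul_eq_zero.1 h2).resolve_left hπ

variable (ρ : 𝓢(V2, ℝ)) (v : V2) (ω : ℝ)

theorem solProfile_mul_Dv (hv : ‖v‖ < 1) (j : Fin 2) {ξ : V2} (hξ : ξ ≠ 0) :
    (4 * Real.pi ^ 2 * Dv v ξ : ℂ) * solProfile ρ v ω j ξ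
      = ((v j - ξ j * (⟪v, ξ⟫ : ℝ) / ‖ξ‖ ^ 2 : ℝ) : ℂ) * invFT ρ ξ
        + Complex.I * (ω : ℂ) * (2 * Real.pi : ℂ)⁻¹ * Jgrad (invFT ρ) j ξ := by
  have hξ : 0 < ‖ξ‖ := norm_pos_iff.2 hξ
  have hv' : 0 < 1 - ‖v‖ ^ 2 := by nlinarith [norm_nonneg v]
  have hD : 0 < Dv v ξ := (by positivity : 0 < (1 - ‖v‖ ^ 2) * ‖ξ‖ ^ 2).trans_le
    (mul_norm_sq_le_Dv v ξ)
  have hD' : ((4 * Real.pi ^ 2 * Dv v ξ : ℝ) : ℂ) ≠ 0 := by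
    have : 0 < 4 * Real.pi ^ 2 * Dv v ξ := by have := Real.pi_pos; positivity
    exact_mod_cast this.ne'
  rw [solProfile_eq, mul_comm,
    show (4 * Real.pi ^ 2 * Dv v ξ : ℂ) = ((4 * Real.pi ^ 2 * Dv v ξ : ℝ) : ℂ) by push_cast; rfl,
    div_mul_cancel₀ _ hD']

theorem sum_inner_e2_sq_sub (ξ : V2) :
    ∑ i, (⟪ξ, e2 i⟫ : ℝ) ^ 2 - (⟪ξ, v⟫ : ℝ) ^ 2 = Dv v ξ := by
  simp only [inner_e2, Dv, EuclideanSpace.real_norm_sq_eq, real_inner_comm]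

theorem sum_Dv_mul_solProfile_mul_fourier (hv : ‖v‖ < 1) (a : Fin 2 → 𝓢(V2, ℝ))
    (hdiv : ∀ y, ∑ j, fderiv ℝ (a j) y (e2 j) = 0) {ξ : V2} (hξ : ξ ≠ 0) :
    ∑ j, (4 * Real.pi ^ 2 * Dv v ξ : ℂ) * solProfile ρ v ω j ξ
        * (𝓕 (toComplexSchwartz (a j)) : 𝓢(V2, ℂ)) ξ
      = ∑ j, ((v j : ℂ) * (invFT ρ ξ * (𝓕 (toComplexSchwartz (a j)) : 𝓢(V2, ℂ)) ξ)
        + Complex.I * (ω : ℂ) * (2 * Real.pi : ℂ)⁻¹ *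
          (Jgrad (invFT ρ) j ξ * (𝓕 (toComplexSchwartz (a j)) : 𝓢(V2, ℂ)) ξ)) := by
  have h := sum_coord_mul_fourier_eq_zero a hdiv ξ
  simp only [solProfile_mul_Dv ρ v ω hv _ hξ, Fin.sum_univ_two] at h ⊢
  push_cast
  linear_combination (-((⟪v, ξ⟫ : ℝ) : ℂ) / (‖ξ‖ : ℂ) ^ 2 * invFT ρ ξ) * h

theorem sum_integral_fderiv_Asol_mul_fderiv (hv : ‖v‖ < 1)
    (hf : ∀ j, Integrable (solProfile ρ v ω j))
    (hf' : ∀ j, Integrable (fun ξ => ‖ξ‖ * ‖solProfile ρ v ω j ξ‖))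
    (a : Fin 2 → 𝓢(V2, ℝ)) (hdiv : ∀ y, ∑ j, fderiv ℝ (a j) y (e2 j) = 0) :
    ∑ j, ((∑ i, ∫ y, fderiv ℝ (Asol ρ v ω j) y (e2 i) * fderiv ℝ (a j) y (e2 i))
        - ∫ y, fderiv ℝ (Asol ρ v ω j) y v * fderiv ℝ (a j) y v)
      = ∑ j, v j * (∫ y, a j y * ρ y)
        + ω * ((∫ y : V2, y 0 * a 1 y * ρ y) - ∫ y : V2, y 1 * a 0 y * ρ y) := by
  set b : Fin 2 → 𝓢(V2, ℂ) := fun j => 𝓕 (toComplexSchwartz (a j)) with hb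
  have hInt := fun j w => integrable_inner_sq_mul_fourier (hf j) (hf' j) (a j) w
  simp only [Asol_eq_re_fourier, fun j w =>
    integral_fderiv_re_fourier_mul_fderiv (hf j) (hf' j) (a j) w]
  have h0 : ∀ (u : Fin 2 → Fin 2 → ℂ) (w : Fin 2 → ℂ),
      ∑ j, (∑ i, (u j i).re - (w j).re) = (∑ j, (∑ i, u j i - w j)).re := by simp
  rw [h0]
  have hL : ∑ j, ((∑ i, ∫ ξ, (4 * Real.pi ^ 2 * (⟪ξ, e2 i⟫ : ℝ) ^ 2 : ℂ) * solProfile ρ v ω j ξ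
          * b j ξ) - ∫ ξ, (4 * Real.pi ^ 2 * (⟪ξ, v⟫ : ℝ) ^ 2 : ℂ) * solProfile ρ v ω j ξ * b j ξ)
      = ∫ ξ, ∑ j, (4 * Real.pi ^ 2 * Dv v ξ : ℂ) * solProfile ρ v ω j ξ * b j ξ := by
    have hS : ∀ j, Integrable (fun ξ => (∑ i, (4 * Real.pi ^ 2 * (⟪ξ, e2 i⟫ : ℝ) ^ 2 : ℂ)
        * solProfile ρ v ω j ξ * b j ξ)
        - (4 * Real.pi ^ 2 * (⟪ξ, v⟫ : ℝ) ^ 2 : ℂ) * solProfile ρ v ω j ξ * b j ξ) := fun j =>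
      (integrable_finsetSum Finset.univ fun i _ => hInt j (e2 i)).sub (hInt j v)
    rw [Finset.sum_congr rfl fun j _ => by
      rw [← integral_finsetSum _ fun i _ => hInt j (e2 i), ← integral_sub
        (integrable_finsetSum Finset.univ fun i _ => hInt j (e2 i)) (hInt j v)],
      ← integral_finsetSum _ fun j _ => hS j]
    refine integral_congr_ae (ae_of_all _ fun ξ => Finset.sum_congr rfl fun j _ => ?_)
    rw [← sum_inner_e2_sq_sub]
    simp only [Fin.sum_univ_two]
    push_cast
    ring
  have hbdd : ∀ (φ ψ : 𝓢(V2, ℂ)), Integrable (fun ξ => φ ξ * ψ ξ) := fun φ ψ => by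
    obtain ⟨K, -, hK⟩ := φ.decay 0 0
    exact ψ.integrable.bdd_mul φ.continuous.aestronglyMeasurable (c := K)
      (ae_of_all _ fun ξ => by simpa using hK ξ)
  have hR : ∀ j, Integrable (fun ξ => invFT ρ ξ * b j ξ) := fun j => hbdd _ _
  have hpd : ∀ k j, Integrable (fun ξ => pd (invFT ρ) k ξ * b j ξ) := fun k j =>
    hbdd (∂_{e2 k} (invFT ρ)) (b j)
  have hRHS : ∫ ξ, ∑ j, (4 * Real.pi ^ 2 * Dv v ξ : ℂ) * solProfile ρ v ω j ξ * b j ξ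
      = ∫ ξ, (((v 0 : ℂ) * (invFT ρ ξ * b 0 ξ) + (v 1 : ℂ) * (invFT ρ ξ * b 1 ξ))
        + Complex.I * (ω : ℂ) * (2 * Real.pi : ℂ)⁻¹ *
          (pd (invFT ρ) 1 ξ * b 0 ξ - pd (invFT ρ) 0 ξ * b 1 ξ)) := by
    refine integral_congr_ae ?_
    filter_upwards [compl_mem_ae_iff.2 (measure_singleton (0 : V2))] with ξ hξ
    rw [sum_Dv_mul_solProfile_mul_fourier ρ v ω hv a hdiv hξ]
    simp only [Fin.sum_univ_two, Jgrad, hb]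
    simp
    ring
  have hK1 : Integrable (fun ξ => (v 0 : ℂ) * (invFT ρ ξ * b 0 ξ)
      + (v 1 : ℂ) * (invFT ρ ξ * b 1 ξ)) := ((hR 0).const_mul _).add ((hR 1).const_mul _)
  have hK2 : Integrable (fun ξ => pd (invFT ρ) 1 ξ * b 0 ξ - pd (invFT ρ) 0 ξ * b 1 ξ) :=
    (hpd 1 0).sub (hpd 0 1)
  rw [hL, hRHS, integral_add hK1 (hK2.const_mul _), integral_add ((hR 0).const_mul _)
    ((hR 1).const_mul _), integral_const_mul, integral_const_mul, integral_const_mul,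
    integral_sub (hpd 1 0) (hpd 0 1)]
  simp only [hb, integral_invFT_mul_fourier, integral_pd_invFT_mul_fourier]
  have hπ : (Real.pi : ℂ) ≠ 0 := by exact_mod_cast Real.pi_ne_zero
  rw [← Complex.ofReal_re (∑ j, v j * (∫ y, a j y * ρ y)
        + ω * ((∫ y : V2, y 0 * a 1 y * ρ y) - ∫ y : V2, y 1 * a 0 y * ρ y))]
  congr 1
  rw [Fin.sum_univ_two]
  push_cast
  field_simp
  linear_combination (ω * ((∫ y : V2, y 1 * a 0 y * ρ y : ℝ) : ℂ)
    - ω * ((∫ y : V2, y 0 * a 1 y * ρ y : ℝ) : ℂ)) * Complex.I_sq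

end WeakEquation

section FieldRegularity

variable {f : V2 → ℂ}

theorem differentiable_re_fourier (hf : Integrable f)
    (hf' : Integrable (fun ξ => ‖ξ‖ * ‖f ξ‖)) : Differentiable ℝ (fun y => (𝓕 f y).re) :=
  Complex.reCLM.differentiable.comp (Real.differentiable_fourier hf hf')

theorem abs_re_fourier_le (y : V2) : |(𝓕 f y).re| ≤ ∫ ξ, ‖f ξ‖ :=
  (Complex.abs_re_le_norm _).trans (VectorFourier.norm_fourierIntegral_le_integral_norm _ _ _ _ _)

theorem memLp_fderiv_re_fourier (hf : Integrable f)
    (hf' : Integrable (fun ξ => ‖ξ‖ * ‖f ξ‖)) (hf2 : MemLp (fun ξ => ‖ξ‖ * ‖f ξ‖) 2) (w : V2) :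
    MemLp (fun y => fderiv ℝ (fun y => (𝓕 f y).re) y w) 2 := by
  have h := (memLp_two_fourier (integrable_inner_mul hf hf' (-(2 * Real.pi * Complex.I)) w)
    (memLp_inner_mul hf hf2 (-(2 * Real.pi * Complex.I)) w)).re
  have h2 : (fun y => fderiv ℝ (fun y => (𝓕 f y).re) y w) = fun y => (𝓕 (fun ξ =>
      -(2 * Real.pi * Complex.I) * ((⟪ξ, w⟫ : ℝ) : ℂ) * f ξ) y).re := by
    ext y
    rw [fderiv_re_apply (Real.differentiable_fourier hf hf' y), fderiv_fourier_apply hf hf']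
  rw [h2]
  exact h

end FieldRegularity

section FirstVariation

theorem hasDerivAt_integral_quadratic {p q r : V2 → ℝ} (hp : Integrable p) (hq : Integrable q)
    (hr : Integrable r) :
    HasDerivAt (fun ε : ℝ => ∫ y, (p y + ε * q y + ε ^ 2 * r y)) (∫ y, q y) 0 := by
  have h : (fun ε : ℝ => ∫ y, (p y + ε * q y + ε ^ 2 * r y))
      = fun ε => (∫ y, p y) + ε * (∫ y, q y) + ε ^ 2 * ∫ y, r y := by
    ext ε
    have h1 : Integrable (fun y => p y + ε * q y) := hp.add (hq.const_mul ε)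
    rw [integral_add h1 (hr.const_mul _), integral_add hp (hq.const_mul _), integral_const_mul,
      integral_const_mul]
  rw [h]
  have h2 := (((hasDerivAt_id (0 : ℝ)).mul_const (∫ y, q y)).const_add (∫ y, p y)).add
    (((hasDerivAt_id (0 : ℝ)).pow 2).mul_const (∫ y, r y))
  exact h2.congr_deriv (by simp)

variable {A Pf : Fin 2 → V2 → ℝ} (a π : Fin 2 → 𝓢(V2, ℝ)) (ρ : 𝓢(V2, ℝ))

theorem fderiv_add_mul_schwartz {u : V2 → ℝ} (hu : Differentiable ℝ u) (b : 𝓢(V2, ℝ)) (ε : ℝ)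
    (y w : V2) :
    fderiv ℝ (fun y => u y + ε * b y) y w = fderiv ℝ u y w + ε * fderiv ℝ b y w := by
  have h := ((hu y).hasFDerivAt.add (b.differentiableAt.hasFDerivAt.const_mul ε)).fderiv
  have h2 := DFunLike.congr_fun h w
  exact h2

theorem memLp_two_fderiv (b : 𝓢(V2, ℝ)) (w : V2) : MemLp (fun y => fderiv ℝ b y w) 2 :=
  (∂_{w} b : 𝓢(V2, ℝ)).memLp 2 volume

theorem hasDerivAt_fieldEnergy (hA : ∀ j, Differentiable ℝ (A j))
    (hA2 : ∀ j w, MemLp (fun y => fderiv ℝ (A j) y w) 2) (hP2 : ∀ j, MemLp (Pf j) 2) :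
    HasDerivAt (fun ε : ℝ => fieldEnergy (fun j y => A j y + ε * a j y)
        (fun j y => Pf j y + ε * π j y))
      ((∑ j, ∫ y, Pf j y * π j y)
        + ∑ j, ∑ i, ∫ y, fderiv ℝ (A j) y (e2 i) * fderiv ℝ (a j) y (e2 i)) 0 := by
  have hπ2 : ∀ j, MemLp (π j) 2 := fun j => (π j).memLp 2
  have ha2 := fun j w => memLp_two_fderiv (a j) w
  have h1 : ∀ j, Integrable (fun y => Pf j y * π j y) := fun j => (hP2 j).integrable_mul (hπ2 j)
  have h2 : ∀ j i, Integrable (fun y => fderiv ℝ (A j) y (e2 i) * fderiv ℝ (a j) y (e2 i)) :=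
    fun j i => (hA2 j _).integrable_mul (ha2 j _)
  have hp : Integrable (fun y => (∑ j, (Pf j y) ^ 2)
      + ∑ i, ∑ j, (fderiv ℝ (A j) y (e2 i)) ^ 2) :=
    (integrable_finsetSum _ fun j _ => (hP2 j).integrable_sq).add
      (integrable_finsetSum _ fun i _ => integrable_finsetSum _ fun j _ =>
        (hA2 j (e2 i)).integrable_sq)
  have hr : Integrable (fun y => (∑ j, (π j y) ^ 2)
      + ∑ i, ∑ j, (fderiv ℝ (a j) y (e2 i)) ^ 2) :=
    (integrable_finsetSum _ fun j _ => (hπ2 j).integrable_sq).add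
      (integrable_finsetSum _ fun i _ => integrable_finsetSum _ fun j _ =>
        (ha2 j (e2 i)).integrable_sq)
  have hq1 : Integrable (fun y => ∑ j, Pf j y * π j y) := integrable_finsetSum _ fun j _ => h1 j
  have hq2 : ∀ j, Integrable (fun y => ∑ i, fderiv ℝ (A j) y (e2 i) * fderiv ℝ (a j) y (e2 i)) :=
    fun j => integrable_finsetSum _ fun i _ => h2 j i
  have hq3 : Integrable (fun y => ∑ j, ∑ i,
      fderiv ℝ (A j) y (e2 i) * fderiv ℝ (a j) y (e2 i)) :=
    integrable_finsetSum _ fun j _ => hq2 j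
  have hq : Integrable (fun y => 2 * ((∑ j, Pf j y * π j y)
      + ∑ j, ∑ i, fderiv ℝ (A j) y (e2 i) * fderiv ℝ (a j) y (e2 i))) :=
    (hq1.add hq3).const_mul 2
  refine (((hasDerivAt_integral_quadratic hp hq hr).const_mul (1 / 2 : ℝ)).congr_of_eventuallyEq
    (Filter.Eventually.of_forall fun ε => ?_)).congr_deriv ?_
  · dsimp only
    rw [fieldEnergy]
    congr 2
    ext y
    simp only [gradSq, fderiv_add_mul_schwartz (hA _), Fin.sum_univ_two]
    ring
  · rw [integral_const_mul, integral_add hq1 hq3, integral_finsetSum _ fun j _ => h1 j,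
      integral_finsetSum _ fun j _ => hq2 j]
    simp_rw [integral_finsetSum _ fun i _ => h2 _ i]
    ring

theorem hasDerivAt_momTerm (hA : ∀ j, Differentiable ℝ (A j))
    (hA2 : ∀ j w, MemLp (fun y => fderiv ℝ (A j) y w) 2) (hP2 : ∀ j, MemLp (Pf j) 2)
    (k : Fin 2) :
    HasDerivAt (fun ε : ℝ => momTerm (fun j y => A j y + ε * a j y)
        (fun j y => Pf j y + ε * π j y) k)
      ((∑ l, ∫ y, π l y * fderiv ℝ (A l) y (e2 k))
        + ∑ l, ∫ y, Pf l y * fderiv ℝ (a l) y (e2 k)) 0 := by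
  have hπ2 : ∀ j, MemLp (π j) 2 := fun j => (π j).memLp 2
  have ha2 := fun j w => memLp_two_fderiv (a j) w
  have h1 : ∀ l, Integrable (fun y => π l y * fderiv ℝ (A l) y (e2 k)) := fun l =>
    (hπ2 l).integrable_mul (hA2 l _)
  have h2 : ∀ l, Integrable (fun y => Pf l y * fderiv ℝ (a l) y (e2 k)) := fun l =>
    (hP2 l).integrable_mul (ha2 l _)
  have hp : Integrable (fun y => ∑ l, Pf l y * fderiv ℝ (A l) y (e2 k)) :=
    integrable_finsetSum _ fun l _ => (hP2 l).integrable_mul (hA2 l _)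
  have hr : Integrable (fun y => ∑ l, π l y * fderiv ℝ (a l) y (e2 k)) :=
    integrable_finsetSum _ fun l _ => (hπ2 l).integrable_mul (ha2 l _)
  have hq1 : Integrable (fun y => ∑ l, π l y * fderiv ℝ (A l) y (e2 k)) :=
    integrable_finsetSum _ fun l _ => h1 l
  have hq2 : Integrable (fun y => ∑ l, Pf l y * fderiv ℝ (a l) y (e2 k)) :=
    integrable_finsetSum _ fun l _ => h2 l
  have hq : Integrable (fun y => (∑ l, π l y * fderiv ℝ (A l) y (e2 k))
      + ∑ l, Pf l y * fderiv ℝ (a l) y (e2 k)) := hq1.add hq2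
  convert hasDerivAt_integral_quadratic hp hq hr using 1
  · ext ε
    rw [momTerm]
    congr 1
    ext y
    simp only [fderiv_add_mul_schwartz (hA _), Fin.sum_univ_two]
    ring
  · rw [integral_add hq1 hq2, integral_finsetSum _ fun l _ => h1 l,
      integral_finsetSum _ fun l _ => h2 l]

theorem integrable_bdd_mul_schwartz {u : V2 → ℝ} {K : ℝ} (hu : Continuous u)
    (hK : ∀ y, |u y| ≤ K) (b : 𝓢(V2, ℝ)) : Integrable (fun y => u y * b y) :=
  b.integrable.bdd_mul hu.aestronglyMeasurable (ae_of_all _ hK)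

theorem hasDerivAt_chargeTerm {K : Fin 2 → ℝ} (hA : ∀ j, Differentiable ℝ (A j))
    (hK : ∀ j y, |A j y| ≤ K j) (j : Fin 2) :
    HasDerivAt (fun ε : ℝ => chargeTerm ρ (fun j y => A j y + ε * a j y) j)
      (∫ y, a j y * ρ y) 0 := by
  obtain ⟨L, -, hL⟩ := (a j).decay 0 0
  have hp := integrable_bdd_mul_schwartz (hA j).continuous (hK j) ρ
  have hq := integrable_bdd_mul_schwartz (a j).continuous (fun y => by simpa using hL y) ρ
  convert hasDerivAt_integral_quadratic hp hq (integrable_zero V2 ℝ volume) using 1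
  ext ε
  rw [chargeTerm]
  congr 1
  ext y
  simp only [Pi.zero_apply]
  ring

theorem exists_schwartz_coord_mul (k : Fin 2) : ∃ σ : 𝓢(V2, ℝ), ∀ y, σ y = y k * ρ y := by
  have ht : (fun x : V2 => (inner ℝ x (e2 k) : ℝ)).HasTemperateGrowth := by fun_prop
  refine ⟨SchwartzMap.smulLeftCLM ℝ (fun x : V2 => (inner ℝ x (e2 k) : ℝ)) ρ, fun y => ?_⟩
  rw [SchwartzMap.smulLeftCLM_apply_apply ht, inner_e2, smul_eq_mul]

theorem hasDerivAt_angTerm {K : Fin 2 → ℝ} (hA : ∀ j, Differentiable ℝ (A j))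
    (hK : ∀ j y, |A j y| ≤ K j) :
    HasDerivAt (fun ε : ℝ => angTerm ρ (fun j y => A j y + ε * a j y))
      ((∫ y : V2, y 1 * a 0 y * ρ y) - ∫ y : V2, y 0 * a 1 y * ρ y) 0 := by
  choose σ hσ using exists_schwartz_coord_mul ρ
  have hp : ∀ j k, Integrable (fun y : V2 => y k * A j y * ρ y) := fun j k =>
    (integrable_bdd_mul_schwartz (hA j).continuous (hK j) (σ k)).congr
      (ae_of_all _ fun y => by simp only [hσ]; ring)
  have hq : ∀ j k, Integrable (fun y : V2 => y k * a j y * ρ y) := fun j k => by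
    obtain ⟨L, -, hL⟩ := (a j).decay 0 0
    exact (integrable_bdd_mul_schwartz (a j).continuous (fun y => by simpa using hL y)
      (σ k)).congr (ae_of_all _ fun y => by simp only [hσ]; ring)
  convert hasDerivAt_integral_quadratic ((hp 0 1).sub (hp 1 0)) ((hq 0 1).sub (hq 1 0))
    (integrable_zero V2 ℝ volume) using 1
  · ext ε
    rw [angTerm]
    congr 1
    ext y
    simp only [Pi.sub_apply, Pi.zero_apply]
    ring
  · exact (integral_sub (hq 0 1) (hq 1 0)).symm

theorem hasDerivAt_Hred {K : Fin 2 → ℝ} (hA : ∀ j, Differentiable ℝ (A j))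
    (hA2 : ∀ j w, MemLp (fun y => fderiv ℝ (A j) y w) 2) (hP2 : ∀ j, MemLp (Pf j) 2)
    (hK : ∀ j y, |A j y| ≤ K j) {m I M ω : ℝ} {P : Fin 2 → ℝ} {v : V2} (hm : m ≠ 0) (hI : I ≠ 0)
    (hP : ∀ j, P j + momTerm A Pf j - chargeTerm ρ A j = m * v j)
    (hM : M + angTerm ρ A = I * ω) :
    HasDerivAt (fun ε : ℝ => Hred m I ρ P M (fun j y => A j y + ε * a j y)
        (fun j y => Pf j y + ε * π j y))
      ((∑ j, ∫ y, Pf j y * π j y)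
        + (∑ j, ∑ i, ∫ y, fderiv ℝ (A j) y (e2 i) * fderiv ℝ (a j) y (e2 i))
        + (∑ j, v j * ((∑ l, ∫ y, π l y * fderiv ℝ (A l) y (e2 j))
          + (∑ l, ∫ y, Pf l y * fderiv ℝ (a l) y (e2 j)) - ∫ y, a j y * ρ y))
        + ω * ((∫ y : V2, y 1 * a 0 y * ρ y) - ∫ y : V2, y 0 * a 1 y * ρ y)) 0 := by
  have hE := hasDerivAt_fieldEnergy a π hA hA2 hP2
  have hmom := hasDerivAt_momTerm a π hA hA2 hP2
  have hch := hasDerivAt_chargeTerm a ρ hA hK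
  have hang := hasDerivAt_angTerm a ρ hA hK
  have hlin := fun j => (((hmom j).const_add (P j)).sub (hch j)).pow 2
  have h := (hE.add ((HasDerivAt.fun_sum fun j (_ : j ∈ Finset.univ) => hlin j).const_mul
    (1 / (2 * m)))).add (((hang.const_add M).pow 2).const_mul (1 / (2 * I)))
  refine h.congr_deriv ?_
  simp only [Pi.sub_apply, zero_mul, add_zero, hP, hM, Nat.cast_ofNat, Nat.add_one_sub_one,
    pow_one, Fin.sum_univ_two]
  field_simp

end FirstVariation

section CoordinateSums

theorem sum_mul_map_e2 (L : V2 →L[ℝ] ℝ) (v : V2) : ∑ j, v j * L (e2 j) = L v := by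
  have h : v = ∑ j, v j • e2 j := by
    ext i
    fin_cases i <;> simp [e2]
  conv_rhs => rw [h]
  simp

theorem sum_mul_integral_mul_fderiv (v : V2) {u g : V2 → ℝ} (hu : ∀ w, Integrable
    (fun y => g y * fderiv ℝ u y w)) :
    ∑ j, v j * ∫ y, g y * fderiv ℝ u y (e2 j) = ∫ y, g y * fderiv ℝ u y v := by
  simp_rw [← integral_const_mul]
  rw [← integral_finsetSum _ fun j _ => (hu (e2 j)).const_mul (v j)]
  refine integral_congr_ae (ae_of_all _ fun y => ?_)
  simp only [← sum_mul_map_e2 (fderiv ℝ u y) v, Finset.mul_sum]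
  exact Finset.sum_congr rfl fun j _ => by ring

end CoordinateSums

/-- the soliton `(A_{v,ω}, Π_{v,ω})` is a critical point of the reduced
Hamiltonian `H_{P,M}` with `P = P_{v,ω}`, `M = M_{v,ω}`: along every solenoidal Schwartz
direction `(a, π)`, the map `ε ↦ H_{P,M}(A_{v,ω}+εa, Π_{v,ω}+επ)` has derivative `0`
at `ε = 0`. -/
theorem soliton_critical_point
    (ρ : SchwartzMap V2 ℝ)
    (hrad : ∀ x y : V2, ‖x‖ = ‖y‖ → ρ x = ρ y)
    (hneu : (∫ x : V2, ρ x) = 0)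
    (m I : ℝ) (hm : 0 < m) (hI : 0 < I)
    (v : V2) (hv : ‖v‖ < 1) (ω : ℝ)
    (a π : Fin 2 → SchwartzMap V2 ℝ)
    (hdiva : ∀ y : V2, (∑ j, fderiv ℝ (⇑(a j)) y (e2 j)) = 0)
    (hdivπ : ∀ y : V2, (∑ j, fderiv ℝ (⇑(π j)) y (e2 j)) = 0) :
    HasDerivAt (fun ε : ℝ =>
      Hred m I (⇑ρ) (Psol (⇑ρ) m v ω) (Msol (⇑ρ) I v ω)
        (fun j y => Asol (⇑ρ) v ω j y + ε * a j y)
        (fun j y => Pisol (⇑ρ) v ω j y + ε * π j y)) 0 0 := by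
  have hneg : ∀ x, ρ (-x) = ρ x := fun x => hrad _ _ (norm_neg x)
  choose C hC using exists_norm_mul_solProfile_le ρ v ω hv hneg hneu
  have hmeas := aestronglyMeasurable_solProfile ρ v ω
  have hf := fun j => integrable_of_norm_mul_le (hmeas j) (hC j)
  have hf' := fun j => integrable_norm_mul_of_norm_mul_le (hmeas j) (hC j)
  have hf2 := fun j => memLp_norm_mul_of_norm_mul_le (hmeas j) (hC j)
  have hA : ∀ j, Differentiable ℝ (Asol ρ v ω j) := fun j => by
    rw [Asol_eq_re_fourier]; exact differentiable_re_fourier (hf j) (hf' j)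
  have hK : ∀ j y, |Asol ρ v ω j y| ≤ ∫ ξ, ‖solProfile ρ v ω j ξ‖ := fun j y => by
    rw [Asol_eq_re_fourier]; exact abs_re_fourier_le y
  have hA2 : ∀ j w, MemLp (fun y => fderiv ℝ (Asol ρ v ω j) y w) 2 := fun j w => by
    rw [Asol_eq_re_fourier]; exact memLp_fderiv_re_fourier (hf j) (hf' j) (hf2 j) w
  have hP2 : ∀ j, MemLp (Pisol ρ v ω j) 2 := fun j => (hA2 j v).neg
  refine (hasDerivAt_Hred a π ρ hA hA2 hP2 hK hm.ne' hI.ne' (v := v) (ω := ω)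
    (fun j => by rw [Psol]; ring) (by rw [Msol]; ring)).congr_deriv ?_
  have hw := sum_integral_fderiv_Asol_mul_fderiv ρ v ω hv hf hf' a hdiva
  have h1 : ∀ l, ∑ j, v j * ∫ y, π l y * fderiv ℝ (Asol ρ v ω l) y (e2 j)
      = -∫ y, Pisol ρ v ω l y * π l y := fun l => by
    rw [sum_mul_integral_mul_fderiv v fun w => ((π l).memLp 2).integrable_mul (hA2 l w),
      ← integral_neg]
    exact integral_congr_ae (ae_of_all _ fun y => by simp only [Pisol]; ring)
  have h2 : ∀ l, ∑ j, v j * ∫ y, Pisol ρ v ω l y * fderiv ℝ (a l) y (e2 j)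
      = -∫ y, fderiv ℝ (Asol ρ v ω l) y v * fderiv ℝ (a l) y v := fun l => by
    rw [sum_mul_integral_mul_fderiv v fun w => (hP2 l).integrable_mul (memLp_two_fderiv (a l) w),
      ← integral_neg]
    exact integral_congr_ae (ae_of_all _ fun y => by simp only [Pisol]; ring)
  have h10 := h1 0
  have h11 := h1 1
  have h20 := h2 0
  have h21 := h2 1
  simp only [Fin.sum_univ_two] at hw h10 h11 h20 h21 ⊢
  linear_combination hw + h10 + h11 + h20 + h21

end
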